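/- arXiv:1606.04589 — 7 statements merged into one kernel-verified Lean document; each statement's English description precedes it below -/
import Mathlib

section
/- If an ES combination operator ∇ satisfies (ESF7) and (ESF8W), then ∇ satisfies the Pareto condition (ESF-P). -/
/- Common framework for logic-based merging of epistemic states
   (Mata Díaz & Pino Pérez, "Impossibility in Belief Merging"). -/

namespace BeliefMerging

/-- A profile: a nonempty finite society of agents together with an
assignment of an epistemic state to each agent of the society. -/
structure Profile (S ℰ : Type) where
  soc : Finset S
  soc_nonempty : soc.Nonempty
  val : {x // x ∈ soc} → ℰ

variable {S ℰ W : Type}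

/-- The singleton profile of agent `i` with epistemic state `E`. -/
def Profile.single (i : S) (E : ℰ) : Profile S ℰ :=
  ⟨{i}, Finset.singleton_nonempty i, fun _ => E⟩

/-- Restriction of a profile to a nonempty subsociety. -/
def Profile.restrict (Φ : Profile S ℰ) (M : Finset S) (hM : M.Nonempty)
    (hsub : M ⊆ Φ.soc) : Profile S ℰ :=
  ⟨M, hM, fun i => Φ.val ⟨i.1, hsub i.2⟩⟩

/-- Equivalence of profiles: societies of the same cardinality whose states
correspond under the unique order-preserving bijection. -/
def Profile.Equiv [LinearOrder S] (Φ Ψ : Profile S ℰ) : Prop :=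
  ∃ h : Φ.soc.card = Ψ.soc.card,
    ∀ k : Fin Φ.soc.card,
      Φ.val (Φ.soc.orderIsoOfFin rfl k) = Ψ.val (Ψ.soc.orderIsoOfFin h.symm k)

/-- (ESF1) -/
def ESF1 (B : ℰ → Set W) (nab : Profile S ℰ → ℰ → ℰ) : Prop :=
  ∀ (Φ : Profile S ℰ) (E : ℰ), B (nab Φ E) ⊆ B E

/-- (ESF2) -/
def ESF2 [LinearOrder S] (B : ℰ → Set W) (nab : Profile S ℰ → ℰ → ℰ) : Prop :=
  ∀ (Φ Φ' : Profile S ℰ) (E E' : ℰ), Profile.Equiv Φ Φ' → B E = B E' →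
    B (nab Φ E) = B (nab Φ' E')

/-- (ESF3) -/
def ESF3 (B : ℰ → Set W) (nab : Profile S ℰ → ℰ → ℰ) : Prop :=
  ∀ (Φ : Profile S ℰ) (E E' E'' : ℰ), B E = B E' ∩ B E'' →
    B (nab Φ E') ∩ B E'' ⊆ B (nab Φ E)

/-- (ESF4) -/
def ESF4 (B : ℰ → Set W) (nab : Profile S ℰ → ℰ → ℰ) : Prop :=
  ∀ (Φ : Profile S ℰ) (E E' E'' : ℰ), B E = B E' ∩ B E'' →
    (B (nab Φ E') ∩ B E'').Nonempty →
    B (nab Φ E) ⊆ B (nab Φ E') ∩ B E''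

/-- ES basic fusion operator: (ESF1)–(ESF4). -/
def BasicFusion [LinearOrder S] (B : ℰ → Set W) (nab : Profile S ℰ → ℰ → ℰ) : Prop :=
  ESF1 B nab ∧ ESF2 B nab ∧ ESF3 B nab ∧ ESF4 B nab

/-- (ESF5) -/
def ESF5 (B : ℰ → Set W) (nab : Profile S ℰ → ℰ → ℰ) : Prop :=
  ∀ (j k : S) (Ej Ek : ℰ), Ej ≠ Ek →
    ∃ E' : ℰ, B (nab (Profile.single j Ej) E') ≠ B (nab (Profile.single k Ek) E')

/-- (ESF6) -/
def ESF6 (B : ℰ → Set W) (nab : Profile S ℰ → ℰ → ℰ) : Prop :=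
  ∀ (Φ : Profile S ℰ) (E : ℰ),
    ((⋂ i : {x // x ∈ Φ.soc}, B (Φ.val i)) ∩ B E).Nonempty →
    B (nab Φ E) = (⋂ i : {x // x ∈ Φ.soc}, B (Φ.val i)) ∩ B E

/-- (ESF7) -/
def ESF7 [DecidableEq S] (B : ℰ → Set W) (nab : Profile S ℰ → ℰ → ℰ) : Prop :=
  ∀ (Φ : Profile S ℰ) (N₁ N₂ : Finset S) (h₁ : N₁.Nonempty) (h₂ : N₂.Nonempty)
    (hs₁ : N₁ ⊆ Φ.soc) (hs₂ : N₂ ⊆ Φ.soc),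
    Disjoint N₁ N₂ → N₁ ∪ N₂ = Φ.soc → ∀ E : ℰ,
      B (nab (Φ.restrict N₁ h₁ hs₁) E) ∩ B (nab (Φ.restrict N₂ h₂ hs₂) E) ⊆
        B (nab Φ E)

/-- (ESF8) -/
def ESF8 [DecidableEq S] (B : ℰ → Set W) (nab : Profile S ℰ → ℰ → ℰ) : Prop :=
  ∀ (Φ : Profile S ℰ) (N₁ N₂ : Finset S) (h₁ : N₁.Nonempty) (h₂ : N₂.Nonempty)
    (hs₁ : N₁ ⊆ Φ.soc) (hs₂ : N₂ ⊆ Φ.soc),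
    Disjoint N₁ N₂ → N₁ ∪ N₂ = Φ.soc → ∀ E : ℰ,
      (B (nab (Φ.restrict N₁ h₁ hs₁) E) ∩ B (nab (Φ.restrict N₂ h₂ hs₂) E)).Nonempty →
      B (nab Φ E) ⊆
        B (nab (Φ.restrict N₁ h₁ hs₁) E) ∩ B (nab (Φ.restrict N₂ h₂ hs₂) E)

/-- (ESF8W) -/
def ESF8W [DecidableEq S] (B : ℰ → Set W) (nab : Profile S ℰ → ℰ → ℰ) : Prop :=
  ∀ (Φ : Profile S ℰ) (N₁ N₂ : Finset S) (h₁ : N₁.Nonempty) (h₂ : N₂.Nonempty)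
    (hs₁ : N₁ ⊆ Φ.soc) (hs₂ : N₂ ⊆ Φ.soc),
    Disjoint N₁ N₂ → N₁ ∪ N₂ = Φ.soc → ∀ E : ℰ,
      (B (nab (Φ.restrict N₁ h₁ hs₁) E) ∩ B (nab (Φ.restrict N₂ h₂ hs₂) E)).Nonempty →
      B (nab Φ E) ⊆
        B (nab (Φ.restrict N₁ h₁ hs₁) E) ∪ B (nab (Φ.restrict N₂ h₂ hs₂) E)

/-- ES fusion operator: (ESF1)–(ESF8). -/
def Fusion [LinearOrder S] (B : ℰ → Set W) (nab : Profile S ℰ → ℰ → ℰ) : Prop :=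
  BasicFusion B nab ∧ ESF5 B nab ∧ ESF6 B nab ∧ ESF7 B nab ∧ ESF8 B nab

/-- ES quasifusion operator: (ESF1)–(ESF7) and (ESF8W). -/
def Quasifusion [LinearOrder S] (B : ℰ → Set W) (nab : Profile S ℰ → ℰ → ℰ) : Prop :=
  BasicFusion B nab ∧ ESF5 B nab ∧ ESF6 B nab ∧ ESF7 B nab ∧ ESF8W B nab

/-- (ESF-SD), Standard Domain. -/
def ESFSD (B : ℰ → Set W) (nab : Profile S ℰ → ℰ → ℰ) : Prop :=
  ∀ (i : S) (w w' w'' : W), w ≠ w' → w ≠ w'' → w' ≠ w'' →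
  ∀ (E₁ E₂ : ℰ), B E₁ = {w, w'} → B E₂ = {w', w''} →
    (∃ Ei : ℰ, B (nab (Profile.single i Ei) E₁) = {w, w'} ∧
               B (nab (Profile.single i Ei) E₂) = {w', w''}) ∧
    (∃ Ei : ℰ, B (nab (Profile.single i Ei) E₁) = {w, w'} ∧
               B (nab (Profile.single i Ei) E₂) = {w'}) ∧
    (∃ Ei : ℰ, B (nab (Profile.single i Ei) E₁) = {w} ∧
               B (nab (Profile.single i Ei) E₂) = {w', w''}) ∧
    (∃ Ei : ℰ, B (nab (Profile.single i Ei) E₁) = {w} ∧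
               B (nab (Profile.single i Ei) E₂) = {w'})

/-- (ESF-U), Unanimity. -/
def ESFU (B : ℰ → Set W) (nab : Profile S ℰ → ℰ → ℰ) : Prop :=
  ∀ (Φ : Profile S ℰ), (∀ i j : {x // x ∈ Φ.soc}, Φ.val i = Φ.val j) →
    ∀ (E : ℰ) (i : {x // x ∈ Φ.soc}),
      B (nab Φ E) = B (nab (Profile.single i.1 (Φ.val i)) E)

/-- (ESF-P), Pareto. -/
def ESFP (B : ℰ → Set W) (nab : Profile S ℰ → ℰ → ℰ) : Prop :=
  ∀ (Φ : Profile S ℰ) (E E' : ℰ),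
    (⋂ i : {x // x ∈ Φ.soc}, B (nab (Profile.single i.1 (Φ.val i)) E)).Nonempty →
    (∀ i : {x // x ∈ Φ.soc}, B (nab (Profile.single i.1 (Φ.val i)) E) ∩ B E' = ∅) →
    B (nab Φ E) ∩ B E' = ∅

/-- (ESF-I), Independence. -/
def ESFI (B : ℰ → Set W) (nab : Profile S ℰ → ℰ → ℰ) : Prop :=
  ∀ (N : Finset S) (hN : N.Nonempty) (f g : {x // x ∈ N} → ℰ) (E : ℰ),
    (∀ E' : ℰ, B E' ⊆ B E → ∀ j : {x // x ∈ N},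
      B (nab (Profile.single j.1 (f j)) E') = B (nab (Profile.single j.1 (g j)) E')) →
    B (nab ⟨N, hN, f⟩ E) = B (nab ⟨N, hN, g⟩ E)

/-- (ESF-D), Dictator. -/
def ESFD (B : ℰ → Set W) (nab : Profile S ℰ → ℰ → ℰ) : Prop :=
  ∀ (N : Finset S) (hN : N.Nonempty), ∃ d : {x // x ∈ N},
    ∀ (f : {x // x ∈ N} → ℰ) (E : ℰ),
      B (nab ⟨N, hN, f⟩ E) ⊆ B (nab (Profile.single d.1 (f d)) E)

/-- The maximal elements of `C` with respect to the total preorder `R`. -/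
def MaxSet (C : Set W) (R : W → W → Prop) : Set W :=
  {w ∈ C | ∀ w' ∈ C, R w w'}

/-- The strict part of a total preorder. -/
def StrictRel (R : W → W → Prop) (a b : W) : Prop := R a b ∧ ¬ R b a

/-- An assignment: each profile is mapped to a total preorder over valuations. -/
def IsAssignment (f : Profile S ℰ → W → W → Prop) : Prop :=
  ∀ Φ : Profile S ℰ, (∀ a b : W, f Φ a b ∨ f Φ b a) ∧
    (∀ a b c : W, f Φ a b → f Φ b c → f Φ a c)

/-- A basic assignment: an assignment sending equivalent profiles to equal preorders. -/
def IsBasicAssignment [LinearOrder S] (f : Profile S ℰ → W → W → Prop) : Prop :=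
  IsAssignment f ∧ ∀ Φ Ψ : Profile S ℰ, Profile.Equiv Φ Ψ → f Φ = f Ψ

/-- The assignment `f` represents the operator `nab`. -/
def Represents (B : ℰ → Set W) (nab : Profile S ℰ → ℰ → ℰ)
    (f : Profile S ℰ → W → W → Prop) : Prop :=
  ∀ (Φ : Profile S ℰ) (E : ℰ), B (nab Φ E) = MaxSet (B E) (f Φ)

/-- Property 1. -/
def Prop1 (f : Profile S ℰ → W → W → Prop) : Prop :=
  ∀ (j k : S) (Ej Ek : ℰ), Ej ≠ Ek →
    f (Profile.single j Ej) ≠ f (Profile.single k Ek)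

/-- Property 2. -/
def Prop2 (B : ℰ → Set W) (f : Profile S ℰ → W → W → Prop) : Prop :=
  ∀ Φ : Profile S ℰ, (⋂ i : {x // x ∈ Φ.soc}, B (Φ.val i)).Nonempty →
    (⋂ i : {x // x ∈ Φ.soc}, B (Φ.val i)) = MaxSet Set.univ (f Φ)

/-- Property 3. -/
def Prop3 [DecidableEq S] (f : Profile S ℰ → W → W → Prop) : Prop :=
  ∀ (Φ : Profile S ℰ) (N₁ N₂ : Finset S) (h₁ : N₁.Nonempty) (h₂ : N₂.Nonempty)
    (hs₁ : N₁ ⊆ Φ.soc) (hs₂ : N₂ ⊆ Φ.soc),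
    Disjoint N₁ N₂ → N₁ ∪ N₂ = Φ.soc → ∀ w w' : W,
      f (Φ.restrict N₁ h₁ hs₁) w w' → f (Φ.restrict N₂ h₂ hs₂) w w' → f Φ w w'

/-- Property 4. -/
def Prop4 [DecidableEq S] (f : Profile S ℰ → W → W → Prop) : Prop :=
  ∀ (Φ : Profile S ℰ) (N₁ N₂ : Finset S) (h₁ : N₁.Nonempty) (h₂ : N₂.Nonempty)
    (hs₁ : N₁ ⊆ Φ.soc) (hs₂ : N₂ ⊆ Φ.soc),
    Disjoint N₁ N₂ → N₁ ∪ N₂ = Φ.soc → ∀ w w' : W,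
      f (Φ.restrict N₁ h₁ hs₁) w w' → StrictRel (f (Φ.restrict N₂ h₂ hs₂)) w w' →
        StrictRel (f Φ) w w'

/-- Property 4′. -/
def Prop4' [DecidableEq S] (f : Profile S ℰ → W → W → Prop) : Prop :=
  ∀ (Φ : Profile S ℰ) (N₁ N₂ : Finset S) (h₁ : N₁.Nonempty) (h₂ : N₂.Nonempty)
    (hs₁ : N₁ ⊆ Φ.soc) (hs₂ : N₂ ⊆ Φ.soc),
    Disjoint N₁ N₂ → N₁ ∪ N₂ = Φ.soc → ∀ w w' : W,
      StrictRel (f (Φ.restrict N₁ h₁ hs₁)) w w' →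
      StrictRel (f (Φ.restrict N₂ h₂ hs₂)) w w' →
        StrictRel (f Φ) w w'

/-- The Maximality Condition. -/
def Maximality (B : ℰ → Set W) (f : Profile S ℰ → W → W → Prop) : Prop :=
  ∀ (i : S) (E : ℰ), B E = MaxSet Set.univ (f (Profile.single i E))

/-- Faithful assignment: basic + Properties 1–4. -/
def IsFaithfulAssignment [LinearOrder S] (B : ℰ → Set W)
    (f : Profile S ℰ → W → W → Prop) : Prop :=
  IsBasicAssignment f ∧ Prop1 f ∧ Prop2 B f ∧ Prop3 f ∧ Prop4 f

/-- Quasifaithful assignment: basic + Properties 1–3 and 4′. -/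
def IsQuasifaithfulAssignment [LinearOrder S] (B : ℰ → Set W)
    (f : Profile S ℰ → W → W → Prop) : Prop :=
  IsBasicAssignment f ∧ Prop1 f ∧ Prop2 B f ∧ Prop3 f ∧ Prop4' f

/-- Property (u). -/
def PropU (f : Profile S ℰ → W → W → Prop) : Prop :=
  ∀ (Φ : Profile S ℰ), (∀ i j : {x // x ∈ Φ.soc}, Φ.val i = Φ.val j) →
    ∀ i : {x // x ∈ Φ.soc}, f Φ = f (Profile.single i.1 (Φ.val i))

/-- Property (p). -/
def PropP (f : Profile S ℰ → W → W → Prop) : Prop :=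
  ∀ (Φ : Profile S ℰ) (w w' : W),
    (∀ i : {x // x ∈ Φ.soc}, StrictRel (f (Profile.single i.1 (Φ.val i))) w w') →
    StrictRel (f Φ) w w'

/-- Two relations coincide on the pair `{w, w'}`. -/
def SameOnPair (R R' : W → W → Prop) (w w' : W) : Prop :=
  (R w w' ↔ R' w w') ∧ (R w' w ↔ R' w' w)

/-- Property (ind). -/
def PropInd (f : Profile S ℰ → W → W → Prop) : Prop :=
  ∀ (N : Finset S) (hN : N.Nonempty) (g g' : {x // x ∈ N} → ℰ) (w w' : W),
    (∀ i : {x // x ∈ N},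
      SameOnPair (f (Profile.single i.1 (g i))) (f (Profile.single i.1 (g' i))) w w') →
    SameOnPair (f ⟨N, hN, g⟩) (f ⟨N, hN, g'⟩) w w'

/-- Property (d). -/
def PropD (f : Profile S ℰ → W → W → Prop) : Prop :=
  ∀ (N : Finset S) (hN : N.Nonempty), ∃ d : {x // x ∈ N},
    ∀ (g : {x // x ∈ N} → ℰ) (w w' : W),
      StrictRel (f (Profile.single d.1 (g d))) w w' → StrictRel (f ⟨N, hN, g⟩) w w'

/-- `D` is a locally decisive `N`-coalition for `E` against `E'`. -/
def LocallyDecisiveFor (B : ℰ → Set W) (nab : Profile S ℰ → ℰ → ℰ)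
    (N : Finset S) (hN : N.Nonempty) (D : Finset S) (hD : D ⊆ N) (E E' : ℰ) : Prop :=
  ∀ f : {x // x ∈ N} → ℰ,
    (∀ i : {x // x ∈ D}, B (nab (Profile.single i.1 (f ⟨i.1, hD i.2⟩)) E) ∩ B E' = ∅) →
    (∀ j : {x // x ∈ N}, j.1 ∉ D → B (nab (Profile.single j.1 (f j)) E) = B E') →
    (⋂ i : {x // x ∈ D}, B (nab (Profile.single i.1 (f ⟨i.1, hD i.2⟩)) E)).Nonempty →
    B (nab ⟨N, hN, f⟩ E) ∩ B E' = ∅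

/-- `D` is a decisive `N`-coalition for `E` against `E'`. -/
def DecisiveFor (B : ℰ → Set W) (nab : Profile S ℰ → ℰ → ℰ)
    (N : Finset S) (hN : N.Nonempty) (D : Finset S) (hD : D ⊆ N) (E E' : ℰ) : Prop :=
  ∀ f : {x // x ∈ N} → ℰ,
    (∀ i : {x // x ∈ D}, B (nab (Profile.single i.1 (f ⟨i.1, hD i.2⟩)) E) ∩ B E' = ∅) →
    (⋂ i : {x // x ∈ D}, B (nab (Profile.single i.1 (f ⟨i.1, hD i.2⟩)) E)).Nonempty →
    B (nab ⟨N, hN, f⟩ E) ∩ B E' = ∅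

/-- `D` is a decisive `N`-coalition. -/
def DecisiveCoalition (B : ℰ → Set W) (nab : Profile S ℰ → ℰ → ℰ)
    (N : Finset S) (hN : N.Nonempty) (D : Finset S) (hD : D ⊆ N) : Prop :=
  ∀ E E' : ℰ, DecisiveFor B nab N hN D hD E E'

end BeliefMerging

namespace BeliefMerging

theorem Profile.mk_singleton_eq_single {S ℰ : Type} (i : S) (h : ({i} : Finset S).Nonempty)
    (f : {x // x ∈ ({i} : Finset S)} → ℰ) :
    (⟨{i}, h, f⟩ : Profile S ℰ) = Profile.single i (f ⟨i, Finset.mem_singleton_self i⟩) := by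
  unfold Profile.single
  congr 1
  funext ⟨x, hx⟩
  obtain rfl := Finset.mem_singleton.mp hx
  rfl

/-- If `w` is accepted by every agent, it is accepted by the society, and the society accepts only
valuations accepted by some agent. -/
theorem mem_and_subset_iUnion_of_forall_mem_single {S ℰ W : Type} [DecidableEq S]
    {B : ℰ → Set W} {nab : Profile S ℰ → ℰ → ℰ} (h7 : ESF7 B nab) (h8w : ESF8W B nab)
    (E : ℰ) (w : W) (N : Finset S) (hN : N.Nonempty) (f : {x // x ∈ N} → ℰ)
    (hw : ∀ i : {x // x ∈ N}, w ∈ B (nab (Profile.single i.1 (f i)) E)) :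
    w ∈ B (nab ⟨N, hN, f⟩ E) ∧
      B (nab ⟨N, hN, f⟩ E) ⊆ ⋃ i : {x // x ∈ N}, B (nab (Profile.single i.1 (f i)) E) := by
  induction hN using Finset.Nonempty.cons_induction with
  | singleton a =>
    rw [Profile.mk_singleton_eq_single]
    exact ⟨hw ⟨a, _⟩, Set.subset_iUnion
      (fun i : {x // x ∈ ({a} : Finset S)} => B (nab (Profile.single i.1 (f i)) E)) ⟨a, _⟩⟩
  | cons a s ha hs ih =>
    have hsub : s ⊆ Finset.cons a s ha := Finset.subset_cons ha
    have hmem : a ∈ Finset.cons a s ha := Finset.mem_cons_self a s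
    have hsub' : {a} ⊆ Finset.cons a s ha := Finset.singleton_subset_iff.mpr hmem
    obtain ⟨hws, hss⟩ := ih (fun i => f ⟨i.1, hsub i.2⟩) fun i => hw ⟨i.1, hsub i.2⟩
    let Φ : Profile S ℰ := ⟨Finset.cons a s ha, Finset.cons_nonempty ha, f⟩
    have hr : Φ.restrict {a} (Finset.singleton_nonempty a) hsub' =
        Profile.single a (f ⟨a, hmem⟩) := Profile.mk_singleton_eq_single a _ _
    have hdisj : Disjoint {a} s := Finset.disjoint_singleton_left.mpr ha
    have hunion : {a} ∪ s = Φ.soc := by simp [Φ]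
    have H7 := h7 Φ {a} s (Finset.singleton_nonempty a) hs hsub' hsub hdisj hunion E
    have H8 := h8w Φ {a} s (Finset.singleton_nonempty a) hs hsub' hsub hdisj hunion E
    rw [hr] at H7 H8
    have hinter := Set.mem_inter (hw ⟨a, hmem⟩) hws
    refine ⟨H7 hinter, fun v hv => Set.mem_iUnion.mpr ?_⟩
    rcases H8 ⟨w, hinter⟩ hv with h | h
    · exact ⟨⟨a, hmem⟩, h⟩
    · obtain ⟨i, hi⟩ := Set.mem_iUnion.mp (hss h)
      exact ⟨⟨i.1, hsub i.2⟩, hi⟩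

end BeliefMerging

open BeliefMerging in
/-- (ESF7) and (ESF8W) entail the Pareto condition (ESF-P). -/
theorem pareto_of_esf7_esf8w
    {S ℰ W : Type} [LinearOrder S] [Nonempty S] [Fintype W] [Nonempty W]
    (B : ℰ → Set W) (hB : ∀ E : ℰ, (B E).Nonempty)
    (hsurj : ∀ A : Set W, A.Nonempty → ∃ E : ℰ, B E = A)
    (nab : Profile S ℰ → ℰ → ℰ)
    (h7 : ESF7 B nab) (h8w : ESF8W B nab) :
    ESFP B nab := by
  rintro ⟨N, hN, f⟩ E E' ⟨w, hw⟩ hdisj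
  refine Set.eq_empty_of_forall_notMem fun v ⟨hv, hv'⟩ => ?_
  obtain ⟨i, hi⟩ := Set.mem_iUnion.mp
    ((mem_and_subset_iUnion_of_forall_mem_single h7 h8w E w N hN f (Set.mem_iInter.mp hw)).2 hv)
  exact Set.notMem_empty v (hdisj i ▸ Set.mem_inter hi hv')
end

section
/- Let ∇ be an ES basic fusion operator with unique representing basic assignment Φ ↦ ≽_Φ. The following are equivalent: (i) ∇ satisfies (ESF-P); (ii) for every society N, every N-profile Φ and all E, E′ ∈ ℰ with |[B(E)]| ≤ 2, if [B(∇(Φ(i),E))] ∩ [B(E′)] = ∅ for every i ∈ N, then [B(∇(Φ,E))] ∩ [B(E′)] = ∅; (iii) the assignment satisfies property (p): for every society N, every N-profile Φ and all valuations w, w′, if w ≻_{Φ(i)} w′ for every i ∈ N, then w ≻_Φ w′. -/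
namespace BeliefMerging

variable {S ℰ W : Type} {B : ℰ → Set W} {nab : Profile S ℰ → ℰ → ℰ}
  {f : Profile S ℰ → W → W → Prop}

/-- The Pareto condition without the common-choice hypothesis, restricted to states with at most
two models. -/
def ParetoOnPairs (B : ℰ → Set W) (nab : Profile S ℰ → ℰ → ℰ) : Prop :=
  ∀ (Φ : Profile S ℰ) (E E' : ℰ), (B E).ncard ≤ 2 →
    (∀ i : {x // x ∈ Φ.soc}, B (nab (Profile.single i.1 (Φ.val i)) E) ∩ B E' = ∅) →
    B (nab Φ E) ∩ B E' = ∅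

theorem IsAssignment.strictRel_of_not (hf : IsAssignment f) {Φ : Profile S ℰ} {a b : W}
    (h : ¬ f Φ b a) : StrictRel (f Φ) a b :=
  ⟨((hf Φ).1 a b).resolve_right h, h⟩

theorem IsAssignment.strictRel_of_mem_of_notMem (hf : IsAssignment f) {Φ : Profile S ℰ}
    {C : Set W} {a b : W} (ha : a ∈ MaxSet C (f Φ)) (hb : b ∈ C) (hb' : b ∉ MaxSet C (f Φ)) :
    StrictRel (f Φ) a b :=
  hf.strictRel_of_not fun hba =>
    hb' ⟨hb, fun c hc => (hf Φ).2 b a c hba (ha.2 c hc)⟩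

theorem IsAssignment.maxSet_pair (hf : IsAssignment f) {Φ : Profile S ℰ} {a b : W}
    (h : StrictRel (f Φ) a b) : MaxSet {a, b} (f Φ) = {a} := by
  ext x
  constructor
  · rintro ⟨rfl | rfl, hx⟩
    · rfl
    · exact absurd (hx a (by simp)) h.2
  · rintro rfl
    refine ⟨by simp, ?_⟩
    rintro y (rfl | rfl)
    · exact or_self_iff.1 ((hf Φ).1 y y)
    · exact h.1

/-- Property (p) only needs the Pareto condition for a pair `{w, w'}` against `{w'}`. -/
theorem propP_of_pair (hf : IsAssignment f) (hrep : Represents B nab f)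
    (hsurj : ∀ A : Set W, A.Nonempty → ∃ E : ℰ, B E = A)
    (h : ∀ (Φ : Profile S ℰ) (E E' : ℰ) (w w' : W), w ≠ w' → B E = {w, w'} → B E' = {w'} →
      (∀ i : {x // x ∈ Φ.soc}, B (nab (Profile.single i.1 (Φ.val i)) E) = {w}) →
      B (nab Φ E) ∩ B E' = ∅) : PropP f := by
  intro Φ w w' hs
  obtain ⟨E, hE⟩ := hsurj {w, w'} ⟨w, by simp⟩
  obtain ⟨E', hE'⟩ := hsurj {w'} ⟨w', rfl⟩
  have hne : w ≠ w' := by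
    rintro rfl
    obtain ⟨i, hi⟩ := Φ.soc_nonempty
    exact (hs ⟨i, hi⟩).2 (hs ⟨i, hi⟩).1
  have hdisj := h Φ E E' w w' hne hE hE' fun i => by
    rw [hrep, hE, hf.maxSet_pair (hs i)]
  refine hf.strictRel_of_not fun hww' => ?_
  have hmem : w' ∈ B (nab Φ E) ∩ B E' := by
    rw [hrep, hE, hE']
    refine ⟨⟨by simp, ?_⟩, rfl⟩
    rintro y (rfl | rfl)
    · exact hww'
    · exact or_self_iff.1 ((hf Φ).1 y y)
  rw [hdisj] at hmem
  exact hmem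

theorem ESFP.propP (hf : IsAssignment f) (hrep : Represents B nab f)
    (hsurj : ∀ A : Set W, A.Nonempty → ∃ E : ℰ, B E = A) (h : ESFP B nab) : PropP f := by
  refine propP_of_pair hf hrep hsurj fun Φ E E' w w' hne _ hE' hi => h Φ E E' ⟨w, ?_⟩ fun i => ?_
  · exact Set.mem_iInter.2 fun i => by rw [hi i]; rfl
  · rw [hi i, hE']
    simpa using hne.symm

theorem ParetoOnPairs.propP (hf : IsAssignment f) (hrep : Represents B nab f)
    (hsurj : ∀ A : Set W, A.Nonempty → ∃ E : ℰ, B E = A) (h : ParetoOnPairs B nab) :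
    PropP f := by
  refine propP_of_pair hf hrep hsurj fun Φ E E' w w' hne hE hE' hi => h Φ E E' ?_ fun i => ?_
  · rw [hE, Set.ncard_pair hne]
  · rw [hi i, hE']
    simpa using hne.symm

theorem PropP.esfp (hf : IsAssignment f) (hrep : Represents B nab f) (h : PropP f) :
    ESFP B nab := by
  rintro Φ E E' ⟨w, hw⟩ hdisj
  refine Set.eq_empty_of_forall_notMem fun x ⟨hx, hxE'⟩ => ?_
  rw [hrep] at hx
  have hstrict : StrictRel (f Φ) w x := h Φ w x fun i => by
    have hwi := Set.mem_iInter.1 hw i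
    have hxi : x ∉ B (nab (Profile.single i.1 (Φ.val i)) E) := fun hxi =>
      Set.eq_empty_iff_forall_notMem.1 (hdisj i) x ⟨hxi, hxE'⟩
    rw [hrep] at hwi hxi
    exact hf.strictRel_of_mem_of_notMem hwi hx.1 hxi
  have hwE : w ∈ B E := by
    obtain ⟨i, hi⟩ := Φ.soc_nonempty
    have hwi := Set.mem_iInter.1 hw ⟨i, hi⟩
    rw [hrep] at hwi
    exact hwi.1
  exact hstrict.2 (hx.2 w hwE)

theorem PropP.paretoOnPairs [Finite W] (hf : IsAssignment f) (hrep : Represents B nab f)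
    (h : PropP f) : ParetoOnPairs B nab := by
  intro Φ E E' hcard hdisj
  refine Set.eq_empty_of_forall_notMem fun x ⟨hx, hxE'⟩ => ?_
  rw [hrep] at hx
  have hbeat : ∀ i : {x // x ∈ Φ.soc},
      ∃ y ∈ B E, y ≠ x ∧ StrictRel (f (Profile.single i.1 (Φ.val i))) y x := fun i => by
    have hxi : x ∉ B (nab (Profile.single i.1 (Φ.val i)) E) := fun hxi =>
      Set.eq_empty_iff_forall_notMem.1 (hdisj i) x ⟨hxi, hxE'⟩
    rw [hrep] at hxi
    by_contra! hno
    refine hxi ⟨hx.1, fun y hy => ?_⟩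
    by_contra hxy
    have hstrict := hf.strictRel_of_not hxy
    refine hno y hy ?_ hstrict
    rintro rfl
    exact hxy hstrict.1
  obtain ⟨i₀, hi₀⟩ := Φ.soc_nonempty
  obtain ⟨y, hy, hyx, -⟩ := hbeat ⟨i₀, hi₀⟩
  have hpair : ({x, y} : Set W) = B E :=
    Set.eq_of_subset_of_ncard_le (Set.insert_subset hx.1 (Set.singleton_subset_iff.2 hy))
      (by rwa [Set.ncard_pair hyx.symm]) (Set.toFinite _)
  have hstrict : StrictRel (f Φ) y x := h Φ y x fun i => by
    obtain ⟨z, hz, hzx, hzs⟩ := hbeat i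
    rw [← hpair] at hz
    obtain rfl | rfl := hz
    · exact absurd rfl hzx
    · exact hzs
  exact hstrict.2 (hx.2 y hy)

end BeliefMerging

open BeliefMerging in
/-- Semantic characterization of the Pareto condition. -/
theorem pareto_characterization
    {S ℰ W : Type} [LinearOrder S] [Nonempty S] [Fintype W] [Nonempty W]
    (B : ℰ → Set W) (hB : ∀ E : ℰ, (B E).Nonempty)
    (hsurj : ∀ A : Set W, A.Nonempty → ∃ E : ℰ, B E = A)
    (nab : Profile S ℰ → ℰ → ℰ) (hbf : BasicFusion B nab)
    (f : Profile S ℰ → W → W → Prop)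
    (hf : IsBasicAssignment f) (hrep : Represents B nab f) :
    (ESFP B nab ↔
      (∀ (Φ : Profile S ℰ) (E E' : ℰ), (B E).ncard ≤ 2 →
        (∀ i : {x // x ∈ Φ.soc},
          B (nab (Profile.single i.1 (Φ.val i)) E) ∩ B E' = ∅) →
        B (nab Φ E) ∩ B E' = ∅)) ∧
    (ESFP B nab ↔ PropP f) := by
  exact
    ⟨⟨fun h => (h.propP hf.1 hrep hsurj).paretoOnPairs hf.1 hrep,
      fun h => (ParetoOnPairs.propP hf.1 hrep hsurj h).esfp hf.1 hrep⟩,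
    ⟨fun h => h.propP hf.1 hrep hsurj, fun h => h.esfp hf.1 hrep⟩⟩
end

section
/- Let ∇ be an ES basic fusion operator with unique representing basic assignment Φ ↦ ≽_Φ. The following are equivalent: (i) ∇ satisfies (ESF-I); (ii) for every society N, all N-profiles Φ, Φ′ and every E ∈ ℰ with |[B(E)]| ≤ 2, if [B(∇(Φ(j),E))] = [B(∇(Φ′(j),E))] for every j ∈ N, then [B(∇(Φ,E))] = [B(∇(Φ′,E))]; (iii) the assignment satisfies property (ind): for every society N, all N-profiles Φ, Φ′ and all valuations w, w′, if the restrictions of ≽_{Φ(i)} and ≽_{Φ′(i)} to {w, w′} coincide for every i ∈ N, then the restrictions of ≽_Φ and ≽_{Φ′} to {w, w′} coincide. -/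
namespace BeliefMerging

theorem maxSet_congr {W : Type} {C : Set W} {R R' : W → W → Prop}
    (h : ∀ a ∈ C, ∀ b ∈ C, (R a b ↔ R' a b)) : MaxSet C R = MaxSet C R' := by
  ext a
  exact and_congr_right fun ha => forall₂_congr fun b hb => h a ha b hb

theorem SameOnPair.maxSet_eq {W : Type} {R R' : W → W → Prop} (hR : ∀ a, R a a)
    (hR' : ∀ a, R' a a) {w w' : W} (h : SameOnPair R R' w w') {C : Set W}
    (hC : C ⊆ {w, w'}) : MaxSet C R = MaxSet C R' := by
  refine maxSet_congr fun a ha b hb => ?_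
  rcases hC ha with rfl | rfl <;> rcases hC hb with rfl | rfl
  · exact iff_of_true (hR _) (hR' _)
  · exact h.1
  · exact h.2
  · exact iff_of_true (hR _) (hR' _)

theorem maxSet_pair_eq_iff {W : Type} {R R' : W → W → Prop} (hR : ∀ a, R a a)
    (hR' : ∀ a, R' a a) (w w' : W) :
    MaxSet {w, w'} R = MaxSet {w, w'} R' ↔ SameOnPair R R' w w' := by
  refine ⟨fun h => ⟨?_, ?_⟩, fun h => h.maxSet_eq hR hR' subset_rfl⟩
  · have := Set.ext_iff.mp h w
    simpa [MaxSet, hR, hR'] using this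
  · have := Set.ext_iff.mp h w'
    simpa [MaxSet, hR, hR'] using this

theorem IsAssignment.refl {S ℰ W : Type} {f : Profile S ℰ → W → W → Prop}
    (hf : IsAssignment f) (Φ : Profile S ℰ) (w : W) : f Φ w w :=
  or_self_iff.mp ((hf Φ).1 w w)

theorem exists_eq_pair_of_ncard_le_two {W : Type} [Finite W] {C : Set W} (hC : C.Nonempty)
    (h : C.ncard ≤ 2) : ∃ w w', C = {w, w'} := by
  have hpos : 0 < C.ncard := (Set.ncard_pos C.toFinite).mpr hC
  obtain h1 | h2 : C.ncard = 1 ∨ C.ncard = 2 := by omega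
  · obtain ⟨w, hw⟩ := Set.ncard_eq_one.mp h1
    exact ⟨w, w, by simpa using hw⟩
  · obtain ⟨w, w', -, hw⟩ := Set.ncard_eq_two.mp h2
    exact ⟨w, w', hw⟩

end BeliefMerging

open BeliefMerging in
/-- Semantic characterization of the Independence condition. -/
theorem independence_characterization
    {S ℰ W : Type} [LinearOrder S] [Nonempty S] [Fintype W] [Nonempty W]
    (B : ℰ → Set W) (hB : ∀ E : ℰ, (B E).Nonempty)
    (hsurj : ∀ A : Set W, A.Nonempty → ∃ E : ℰ, B E = A)
    (nab : Profile S ℰ → ℰ → ℰ) (hbf : BasicFusion B nab)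
    (f : Profile S ℰ → W → W → Prop)
    (hf : IsBasicAssignment f) (hrep : Represents B nab f) :
    (ESFI B nab ↔
      (∀ (N : Finset S) (hN : N.Nonempty) (g g' : {x // x ∈ N} → ℰ) (E : ℰ),
        (B E).ncard ≤ 2 →
        (∀ j : {x // x ∈ N},
          B (nab (Profile.single j.1 (g j)) E) = B (nab (Profile.single j.1 (g' j)) E)) →
        B (nab ⟨N, hN, g⟩ E) = B (nab ⟨N, hN, g'⟩ E))) ∧
    (ESFI B nab ↔ PropInd f) := by
  have hrefl := hf.1.refl
  have hpair (Φ Ψ : Profile S ℰ) (E : ℰ) (w w' : W) (hE : B E = {w, w'}) :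
      B (nab Φ E) = B (nab Ψ E) ↔ SameOnPair (f Φ) (f Ψ) w w' := by
    rw [hrep, hrep, hE, maxSet_pair_eq_iff (hrefl Φ) (hrefl Ψ)]
  have hind : ESFI B nab ↔ PropInd f := by
    constructor
    · intro h N hN g g' w w' hs
      obtain ⟨E, hE⟩ := hsurj {w, w'} ⟨w, Or.inl rfl⟩
      refine (hpair _ _ E w w' hE).mp (h N hN g g' E fun E' hE' j => ?_)
      rw [hrep, hrep]
      exact (hs j).maxSet_eq (hrefl _) (hrefl _) (hE ▸ hE')
    · intro h N hN g g' E hs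
      rw [hrep, hrep]
      refine maxSet_congr fun w hw w' hw' => (h N hN g g' w w' fun j => ?_).1
      obtain ⟨E', hE'⟩ := hsurj {w, w'} ⟨w, Or.inl rfl⟩
      refine (hpair _ _ E' w w' hE').mp (hs E' ?_ j)
      rw [hE']
      exact Set.pair_subset hw hw'
  refine ⟨hind.trans ⟨fun h N hN g g' E hE hs => ?_, fun h N hN g g' w w' hs => ?_⟩, hind⟩
  · obtain ⟨w, w', hw⟩ := exists_eq_pair_of_ncard_le_two (hB E) hE
    exact (hpair _ _ E w w' hw).mpr
      (h N hN g g' w w' fun j => (hpair _ _ E w w' hw).mp (hs j))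
  · obtain ⟨E, hE⟩ := hsurj {w, w'} ⟨w, Or.inl rfl⟩
    exact (hpair _ _ E w w' hE).mp (h N hN g g' E (hE ▸ (Set.ncard_insert_le w {w'}).trans (by simp))
      fun j => (hpair _ _ E w w' hE).mpr (hs j))
end

section
/- If an ES basic fusion operator ∇ satisfies (ESF-U) and (ESF-I), then ∇ satisfies (ESF-P). -/
namespace BeliefMerging

/-- Singleton profiles carrying the same epistemic state are equivalent. -/
theorem Profile.equiv_single {S ℰ : Type} [LinearOrder S] (i j : S) (E : ℰ) :
    Profile.Equiv (Profile.single i E) (Profile.single j E) :=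
  ⟨by simp [Profile.single], fun _ => rfl⟩

/-- Restricting the integrity constraint to a set that meets the result of the fusion
intersects the result with that set. -/
theorem BasicFusion.eq_inter {S ℰ W : Type} [LinearOrder S] {B : ℰ → Set W}
    {nab : Profile S ℰ → ℰ → ℰ} (h : BasicFusion B nab) (Φ : Profile S ℰ) {E E₁ : ℰ}
    (hsub : B E₁ ⊆ B E) (hne : (B (nab Φ E) ∩ B E₁).Nonempty) :
    B (nab Φ E₁) = B (nab Φ E) ∩ B E₁ := by
  have hE : B E₁ = B E ∩ B E₁ := (Set.inter_eq_right.mpr hsub).symm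
  exact (h.2.2.2 Φ E₁ E E₁ hE hne).antisymm (h.2.2.1 Φ E₁ E E₁ hE)

end BeliefMerging

open BeliefMerging in
/-- For ES basic fusion operators, Unanimity and Independence entail Pareto. -/
theorem pareto_of_unanimity_independence
    {S ℰ W : Type} [LinearOrder S] [Nonempty S] [Fintype W] [Nonempty W]
    (B : ℰ → Set W) (hB : ∀ E : ℰ, (B E).Nonempty)
    (hsurj : ∀ A : Set W, A.Nonempty → ∃ E : ℰ, B E = A)
    (nab : Profile S ℰ → ℰ → ℰ) (hbf : BasicFusion B nab)
    (hu : ESFU B nab) (hi : ESFI B nab) :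
    ESFP B nab := by
  rintro ⟨N, hN, f⟩ E E' ⟨w, hw⟩ hdisj
  rw [Set.mem_iInter] at hw
  by_contra hne
  obtain ⟨w', hw'N, hw'E'⟩ := Set.nonempty_iff_ne_empty.mpr hne
  have hw' : ∀ i : {x // x ∈ N}, w' ∉ B (nab (Profile.single i.1 (f i)) E) :=
    fun i h => (Set.eq_empty_iff_forall_notMem.mp (hdisj i)) w' ⟨h, hw'E'⟩
  obtain ⟨i₀⟩ : Nonempty {x // x ∈ N} := hN.to_subtype
  have hpair : ({w, w'} : Set W) ⊆ B E :=
    Set.pair_subset (hbf.1 _ _ (hw i₀)) (hbf.1 _ _ hw'N)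
  have hsingle : ∀ (i : {x // x ∈ N}) (E₁ : ℰ), B E₁ = {w, w'} →
      B (nab (Profile.single i.1 (f i)) E₁) = {w} := by
    intro i E₁ hE₁
    rw [hbf.eq_inter _ (hE₁ ▸ hpair) ⟨w, hw i, by simp [hE₁]⟩, hE₁]
    ext x
    constructor
    · rintro ⟨hx, rfl | rfl⟩
      · rfl
      · exact absurd hx (hw' i)
    · rintro rfl
      exact ⟨hw i, Or.inl rfl⟩
  have htransfer : ∀ (j : {x // x ∈ N}) (E₁ : ℰ),
      B (nab (Profile.single j.1 (f i₀)) E₁) = B (nab (Profile.single i₀.1 (f i₀)) E₁) :=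
    fun j E₁ => hbf.2.1 _ _ _ _ (Profile.equiv_single _ _ _) rfl
  have hsingleton : ∀ (Φ : Profile S ℰ) (E₁ : ℰ) (v : W), B E₁ = {v} → B (nab Φ E₁) = {v} :=
    fun Φ E₁ v h => (Set.Nonempty.subset_singleton_iff (hB _)).mp (h ▸ hbf.1 Φ E₁)
  obtain ⟨E₀, hE₀⟩ := hsurj {w, w'} (Set.insert_nonempty _ _)
  have hind : B (nab ⟨N, hN, f⟩ E₀) = B (nab ⟨N, hN, fun _ => f i₀⟩ E₀) := by
    refine hi N hN f (fun _ => f i₀) E₀ fun E₁ hE₁ j => ?_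
    rw [hE₀, Set.subset_pair_iff_eq] at hE₁
    rcases hE₁ with h | h | h | h
    · exact absurd h (hB E₁).ne_empty
    · rw [hsingleton _ _ _ h, hsingleton _ _ _ h]
    · rw [hsingleton _ _ _ h, hsingleton _ _ _ h]
    · rw [hsingle j E₁ h, htransfer, hsingle i₀ E₁ h]
  have hunan : B (nab ⟨N, hN, fun _ => f i₀⟩ E₀) = {w} :=
    (hu ⟨N, hN, fun _ => f i₀⟩ (fun _ _ => rfl) E₀ i₀).trans (hsingle i₀ E₀ hE₀)
  have hmem : w' ∈ B (nab ⟨N, hN, f⟩ E₀) := by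
    have hw'E₀ : w' ∈ B E₀ := by simp [hE₀]
    rw [hbf.eq_inter _ (hE₀ ▸ hpair) ⟨w', hw'N, hw'E₀⟩]
    exact ⟨hw'N, hw'E₀⟩
  rw [hind, hunan, Set.mem_singleton_iff] at hmem
  exact hw' i₀ (hmem ▸ hw i₀)
end

section
/- Let ∇ be an ES basic fusion operator with unique representing basic assignment Φ ↦ ≽_Φ. The following are equivalent: (i) ∇ satisfies (ESF-D); (ii) for every society N there exists d ∈ N such that for every N-profile Φ and every E ∈ ℰ with |[B(E)]| ≤ 2, [B(∇(Φ,E))] ⊆ [B(∇(Φ(d),E))]; (iii) the assignment satisfies property (d): for every society N there exists d ∈ N such that for every N-profile Φ and all valuations w, w′, if w ≻_{Φ(d)} w′ then w ≻_Φ w′. -/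
/- Common framework for logic-based merging of epistemic states
   (Mata Díaz & Pino Pérez, "Impossibility in Belief Merging"). -/

namespace BeliefMerging

variable {S ℰ W : Type}

theorem maxSet_subset_maxSet {R T : W → W → Prop} (hT : ∀ a b, T a b ∨ T b a)
    (h : ∀ w w', StrictRel T w w' → StrictRel R w w') (C : Set W) :
    MaxSet C R ⊆ MaxSet C T := by
  rintro w ⟨hw, hmax⟩
  refine ⟨hw, fun w' hw' => ?_⟩
  by_contra hn
  exact (h w' w ⟨(hT w w').resolve_left hn, hn⟩).2 (hmax w' hw')

theorem StrictRel.of_maxSet_pair_subset {R T : W → W → Prop} {w w' : W}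
    (hR : ∀ a b, R a b ∨ R b a) (h : MaxSet {w, w'} R ⊆ MaxSet {w, w'} T)
    (hT : StrictRel T w w') : StrictRel R w w' := by
  have hn : ¬ R w' w := by
    intro hw
    have hmem : w' ∈ MaxSet {w, w'} R := by
      refine ⟨by simp, ?_⟩
      rintro v (rfl | rfl)
      · exact hw
      · exact (hR v v).elim id id
    exact hT.2 ((h hmem).2 w (by simp))
  exact ⟨(hR w w').resolve_right hn, hn⟩

end BeliefMerging

open BeliefMerging in
/-- Semantic characterization of dictatorial operators. -/
theorem dictator_characterization
    {S ℰ W : Type} [LinearOrder S] [Nonempty S] [Fintype W] [Nonempty W]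
    (B : ℰ → Set W) (hB : ∀ E : ℰ, (B E).Nonempty)
    (hsurj : ∀ A : Set W, A.Nonempty → ∃ E : ℰ, B E = A)
    (nab : Profile S ℰ → ℰ → ℰ) (hbf : BasicFusion B nab)
    (f : Profile S ℰ → W → W → Prop)
    (hf : IsBasicAssignment f) (hrep : Represents B nab f) :
    (ESFD B nab ↔
      (∀ (N : Finset S) (hN : N.Nonempty), ∃ d : {x // x ∈ N},
        ∀ (g : {x // x ∈ N} → ℰ) (E : ℰ), (B E).ncard ≤ 2 →
          B (nab ⟨N, hN, g⟩ E) ⊆ B (nab (Profile.single d.1 (g d)) E))) ∧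
    (ESFD B nab ↔ PropD f) := by
  have restrict_pairs : ESFD B nab →
      (∀ (N : Finset S) (hN : N.Nonempty), ∃ d : {x // x ∈ N},
        ∀ (g : {x // x ∈ N} → ℰ) (E : ℰ), (B E).ncard ≤ 2 →
          B (nab ⟨N, hN, g⟩ E) ⊆ B (nab (Profile.single d.1 (g d)) E)) :=
    fun h N hN => (h N hN).imp fun _ hd g E _ => hd g E
  have propD_of_pairs : (∀ (N : Finset S) (hN : N.Nonempty), ∃ d : {x // x ∈ N},
        ∀ (g : {x // x ∈ N} → ℰ) (E : ℰ), (B E).ncard ≤ 2 →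
          B (nab ⟨N, hN, g⟩ E) ⊆ B (nab (Profile.single d.1 (g d)) E)) → PropD f := by
    intro h N hN
    obtain ⟨d, hd⟩ := h N hN
    refine ⟨d, fun g w w' hs => ?_⟩
    obtain ⟨E, hE⟩ := hsurj {w, w'} (Set.insert_nonempty _ _)
    have hsub := hd g E (by rw [hE]; exact (Set.ncard_insert_le w _).trans (by simp))
    rw [hrep, hrep, hE] at hsub
    exact hs.of_maxSet_pair_subset (hf.1 _).1 hsub
  have esfd_of_propD : PropD f → ESFD B nab := by
    intro h N hN
    obtain ⟨d, hd⟩ := h N hN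
    refine ⟨d, fun g E => ?_⟩
    rw [hrep, hrep]
    exact maxSet_subset_maxSet (hf.1 _).1 (hd g) _
  exact ⟨⟨restrict_pairs, esfd_of_propD ∘ propD_of_pairs⟩,
    ⟨propD_of_pairs ∘ restrict_pairs, esfd_of_propD⟩⟩
end

section
/- Let ∇ be an ES combination operator and N a society. If D ⊆ N is a decisive N-coalition with respect to ∇ and D = {d} has exactly one element, then d is a dictator in N: [B(∇(Φ,E))] ⊆ [B(∇(Φ(d),E))] for every N-profile Φ and every epistemic state E ∈ ℰ. -/
open BeliefMerging in
/-- A decisive coalition with exactly one element consists of a dictator in `N`. -/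
theorem singleton_decisive_is_dictator
    {S ℰ W : Type} [LinearOrder S] [Nonempty S] [Fintype W] [Nonempty W]
    (B : ℰ → Set W) (hB : ∀ E : ℰ, (B E).Nonempty)
    (hsurj : ∀ A : Set W, A.Nonempty → ∃ E : ℰ, B E = A)
    (nab : Profile S ℰ → ℰ → ℰ)
    (N : Finset S) (hN : N.Nonempty) (d : S) (hd : d ∈ N)
    (hdec : DecisiveCoalition B nab N hN {d} (Finset.singleton_subset_iff.mpr hd)) :
    ∀ (g : {x // x ∈ N} → ℰ) (E : ℰ),
      B (nab ⟨N, hN, g⟩ E) ⊆ B (nab (Profile.single d (g ⟨d, hd⟩)) E) := by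
  intro g E w hw
  by_contra hwd
  obtain ⟨E', hE'⟩ := hsurj {w} (Set.singleton_nonempty w)
  have hempty : B (nab ⟨N, hN, g⟩ E) ∩ B E' = ∅ := by
    refine hdec E E' g ?_ ?_
    · rintro ⟨i, hi⟩
      obtain rfl := Finset.mem_singleton.mp hi
      rw [hE']
      exact Set.inter_singleton_eq_empty.mpr hwd
    · obtain ⟨v, hv⟩ := hB (nab (Profile.single d (g ⟨d, hd⟩)) E)
      refine ⟨v, Set.mem_iInter.mpr ?_⟩
      rintro ⟨i, hi⟩
      obtain rfl := Finset.mem_singleton.mp hi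
      exact hv
  rw [hE', Set.inter_singleton_eq_empty] at hempty
  exact hempty hw
end

section
/- First propagation lemma: let N be a society, D an N-coalition, and ∇ an ES basic fusion operator satisfying (ESF-SD), (ESF-P) and (ESF-I). Let w, w′ be distinct valuations and E_{w,w′}, E_{w′} epistemic states with [B(E_{w,w′})] = {w,w′} and [B(E_{w′})] = {w′}, and suppose D is locally decisive for E_{w,w′} against E_{w′}. Then for every valuation w″ ∉ {w,w′} and all epistemic states E_{w,w″}, E_{w″} with [B(E_{w,w″})] = {w,w″} and [B(E_{w″})] = {w″}, the coalition D is decisive for E_{w,w″} against E_{w″}. -/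
namespace BeliefMerging

theorem Profile.Equiv.refl {S ℰ : Type} [LinearOrder S] (Φ : Profile S ℰ) :
    Profile.Equiv Φ Φ :=
  ⟨rfl, fun _ => rfl⟩

/-- The strict preference for `a` over `b`, followed by a weak preference for `b` over `c`,
yields a strict preference for `a` over `c`. -/
theorem BasicFusion.strict_trans {S ℰ W : Type} [LinearOrder S] {B : ℰ → Set W}
    (hB : ∀ E : ℰ, (B E).Nonempty) (hsurj : ∀ A : Set W, A.Nonempty → ∃ E : ℰ, B E = A)
    {nab : Profile S ℰ → ℰ → ℰ} (hbf : BasicFusion B nab) (Φ : Profile S ℰ)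
    {a b c : W} (hab : a ≠ b) {Eab Ebc Eac : ℰ}
    (h₁ : B Eab = {a, b}) (h₂ : B Ebc = {b, c}) (h₃ : B Eac = {a, c})
    (ha : B (nab Φ Eab) = {a}) (hb : b ∈ B (nab Φ Ebc)) :
    B (nab Φ Eac) = {a} := by
  obtain ⟨f1, -, f3, f4⟩ := hbf
  obtain ⟨F, hF⟩ := hsurj {a, b, c} ⟨a, by simp⟩
  have eab : B Eab = B F ∩ B Eab := by
    rw [hF, h₁]; ext x; simp; tauto
  have ebc : B Ebc = B F ∩ B Ebc := by
    rw [hF, h₂]; ext x; simp; tauto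
  have eac : B Eac = B F ∩ B Eac := by
    rw [hF, h₃]; ext x; simp; tauto
  have nb : b ∉ B (nab Φ F) := fun hbF => by
    have hmem : b ∈ B (nab Φ Eab) := f3 Φ _ _ _ eab ⟨hbF, by simp [h₁]⟩
    rw [ha] at hmem
    exact hab hmem.symm
  have nc : c ∉ B (nab Φ F) := fun hcF =>
    nb (f4 Φ _ _ _ ebc ⟨c, hcF, by simp [h₂]⟩ hb).1
  have only_a : ∀ x ∈ B (nab Φ F), x = a := fun x hx => by
    have hxF := f1 Φ F hx
    rw [hF] at hxF
    rcases hxF with rfl | rfl | rfl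
    · rfl
    · exact absurd hx nb
    · exact absurd hx nc
  obtain ⟨x, hx⟩ := hB (nab Φ F)
  have haF : a ∈ B (nab Φ F) := only_a x hx ▸ hx
  refine (hB _).subset_singleton_iff.1 fun y hy => ?_
  exact only_a y (f4 Φ _ _ _ eac ⟨a, haF, by simp [h₃]⟩ hy).1

/-- An agent can be given preferences in which `b` is strictly above `a` while keeping any
prescribed outcome on `{a, c}`, and with `b` strictly above `c`. -/
theorem exists_single_top {S ℰ W : Type} [LinearOrder S] {B : ℰ → Set W}
    (hB : ∀ E : ℰ, (B E).Nonempty) (hsurj : ∀ A : Set W, A.Nonempty → ∃ E : ℰ, B E = A)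
    {nab : Profile S ℰ → ℰ → ℰ} (hbf : BasicFusion B nab) (hsd : ESFSD B nab)
    {a b c : W} (hab : a ≠ b) (hac : a ≠ c) (hbc : b ≠ c) {Eab Ebc Eac : ℰ}
    (h₁ : B Eab = {a, b}) (h₂ : B Ebc = {b, c}) (h₃ : B Eac = {a, c})
    (i : S) (A : Set W) (hA : A.Nonempty) (hsub : A ⊆ {a, c}) :
    ∃ E : ℰ, B (nab (Profile.single i E) Ebc) = {b} ∧
      B (nab (Profile.single i E) Eab) = {b} ∧ B (nab (Profile.single i E) Eac) = A := by
  have h₁' : B Eab = {b, a} := by rw [h₁, Set.pair_comm]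
  have h₃' : B Eac = {c, a} := by rw [h₃, Set.pair_comm]
  obtain ⟨-, -, ⟨E₁, p₁, q₁⟩, ⟨E₂, p₂, q₂⟩⟩ := hsd i b a c hab.symm hbc hac Eab Eac h₁' h₃
  obtain ⟨-, -, -, ⟨E₃, p₃, q₃⟩⟩ := hsd i b c a hbc hab.symm hac.symm Ebc Eac h₂ h₃'
  rcases Set.subset_pair_iff_eq.1 hsub with rfl | rfl | rfl | rfl
  · exact absurd hA Set.not_nonempty_empty
  · exact ⟨E₂, hbf.strict_trans hB hsurj _ hab.symm h₁' h₃ h₂ p₂ (by simp [q₂]), p₂, q₂⟩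
  · exact ⟨E₃, p₃, hbf.strict_trans hB hsurj _ hbc h₂ h₃' h₁' p₃ (by simp [q₃]), q₃⟩
  · exact ⟨E₁, hbf.strict_trans hB hsurj _ hab.symm h₁' h₃ h₂ p₁ (by simp [q₁]), p₁, q₁⟩

/-- Agreement of individual outcomes on a pair forces agreement of collective outcomes. -/
theorem ESFI.eq_of_pair {S ℰ W : Type} [LinearOrder S] {B : ℰ → Set W}
    (hB : ∀ E : ℰ, (B E).Nonempty) {nab : Profile S ℰ → ℰ → ℰ} (hbf : BasicFusion B nab)
    (hi : ESFI B nab) {N : Finset S} (hN : N.Nonempty) (f g : {x // x ∈ N} → ℰ)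
    {a c : W} {E : ℰ} (hE : B E = {a, c})
    (h : ∀ j : {x // x ∈ N},
      B (nab (Profile.single j.1 (f j)) E) = B (nab (Profile.single j.1 (g j)) E)) :
    B (nab ⟨N, hN, f⟩ E) = B (nab ⟨N, hN, g⟩ E) := by
  refine hi N hN f g E fun E' hE' j => ?_
  have singleton_case : ∀ x, B E' = {x} → ∀ Φ : Profile S ℰ, B (nab Φ E') = {x} :=
    fun x hx Φ => (hB _).subset_singleton_iff.1 (hx ▸ hbf.1 Φ E')
  rcases Set.subset_pair_iff_eq.1 (hE ▸ hE') with h' | h' | h' | h'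
  · exact absurd h' (hB E').ne_empty
  · rw [singleton_case _ h', singleton_case _ h']
  · rw [singleton_case _ h', singleton_case _ h']
  · have e : B E' = B E := h'.trans hE.symm
    rw [hbf.2.1 _ _ _ _ (Profile.Equiv.refl _) e, h j,
      hbf.2.1 _ _ _ _ (Profile.Equiv.refl _) e.symm]

/-- An outcome on `{a, c}` avoiding `c` is exactly `{a}`. -/
theorem BasicFusion.eq_singleton_of_inter_eq_empty {S ℰ W : Type} [LinearOrder S]
    {B : ℰ → Set W} (hB : ∀ E : ℰ, (B E).Nonempty) {nab : Profile S ℰ → ℰ → ℰ}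
    (hbf : BasicFusion B nab) {Φ : Profile S ℰ} {a c : W} {E : ℰ} (hE : B E = {a, c})
    (h : B (nab Φ E) ∩ {c} = ∅) : B (nab Φ E) = {a} := by
  refine (hB _).subset_singleton_iff.1 fun x hx => ?_
  have hxE := hbf.1 Φ E hx
  rw [hE] at hxE
  rcases hxE with rfl | rfl
  · rfl
  · exact absurd (show x ∈ B (nab Φ E) ∩ {x} from ⟨hx, rfl⟩) (by simp [h])

end BeliefMerging

open BeliefMerging in
/-- First propagation lemma. -/
theorem first_propagation
    {S ℰ W : Type} [LinearOrder S] [Nonempty S] [Fintype W] [Nonempty W]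
    (hcard : 4 ≤ Fintype.card W)
    (B : ℰ → Set W) (hB : ∀ E : ℰ, (B E).Nonempty)
    (hsurj : ∀ A : Set W, A.Nonempty → ∃ E : ℰ, B E = A)
    (nab : Profile S ℰ → ℰ → ℰ) (hbf : BasicFusion B nab)
    (hsd : ESFSD B nab) (hp : ESFP B nab) (hi : ESFI B nab)
    (N : Finset S) (hN : N.Nonempty) (D : Finset S) (hD : D ⊆ N)
    (w w' : W) (hww' : w ≠ w')
    (Eww' Ew' : ℰ) (h₁ : B Eww' = {w, w'}) (h₂ : B Ew' = {w'})
    (hloc : LocallyDecisiveFor B nab N hN D hD Eww' Ew') :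
    ∀ w'' : W, w'' ∉ ({w, w'} : Set W) →
      ∀ Eww'' Ew'' : ℰ, B Eww'' = {w, w''} → B Ew'' = {w''} →
        DecisiveFor B nab N hN D hD Eww'' Ew'' := by
  intro w'' hw'' Eww'' Ew'' h₃ h₄ f hf _
  have hw : w ≠ w'' := fun h => hw'' (by simp [h])
  have hw' : w' ≠ w'' := fun h => hw'' (by simp [h])
  obtain ⟨E, hE⟩ := hsurj {w', w''} ⟨w', by simp⟩
  have key : ∀ j : {x // x ∈ N}, ∃ X : ℰ, B (nab (Profile.single j.1 X) E) = {w'} ∧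
      (j.1 ∈ D → B (nab (Profile.single j.1 X) Eww') = {w}) ∧
      (j.1 ∉ D → B (nab (Profile.single j.1 X) Eww') = {w'}) ∧
      B (nab (Profile.single j.1 (f j)) Eww'') = B (nab (Profile.single j.1 X) Eww'') := by
    intro j
    by_cases hj : j.1 ∈ D
    · obtain ⟨-, -, -, ⟨X, p, q⟩⟩ := hsd j.1 w w' w'' hww' hw hw' Eww' E h₁ hE
      have hfj := hf ⟨j.1, hj⟩
      rw [h₄] at hfj
      refine ⟨X, q, fun _ => p, fun h => absurd hj h, ?_⟩
      rw [hbf.strict_trans hB hsurj _ hww' h₁ hE h₃ p (by simp [q])]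
      exact hbf.eq_singleton_of_inter_eq_empty hB h₃ hfj
    · obtain ⟨X, p, q, r⟩ := exists_single_top hB hsurj hbf hsd hww' hw hw' h₁ hE h₃ j.1
        (B (nab (Profile.single j.1 (f j)) Eww'')) (hB _) (h₃ ▸ hbf.1 _ _)
      exact ⟨X, p, fun h => absurd h hj, fun _ => q, r.symm⟩
  choose g hg hgD hgD' hfg using key
  have top : B (nab ⟨N, hN, g⟩ Eww') = {w} := by
    refine hbf.eq_singleton_of_inter_eq_empty hB h₁ (h₂ ▸ hloc g (fun i => ?_)
      (fun j hj => by rw [hgD' j hj, h₂]) ⟨w, Set.mem_iInter.2 fun i => ?_⟩)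
    · rw [hgD ⟨i.1, hD i.2⟩ i.2, h₂]
      simpa using hww'.symm
    · rw [hgD ⟨i.1, hD i.2⟩ i.2]
      rfl
  have mid : B (nab ⟨N, hN, g⟩ E) = {w'} := by
    refine hbf.eq_singleton_of_inter_eq_empty hB hE (h₄ ▸ hp ⟨N, hN, g⟩ E Ew''
      ⟨w', Set.mem_iInter.2 fun i => ?_⟩ fun i => ?_)
    · rw [hg i]
      rfl
    · rw [hg i, h₄]
      simpa using hw'.symm
  rw [hi.eq_of_pair hB hbf hN f g h₃ hfg,
    hbf.strict_trans hB hsurj _ hww' h₁ hE h₃ top (by simp [mid]), h₄]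
  simpa using hw.symm
end
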